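/- arXiv:2504.21603 — 4 statements merged into one kernel-verified Lean document; each statement's English description precedes it below -/
import Mathlib

section
/- Suppose v₀ < p₀·k/(μ₀·L·β). Then the function p(x) = p₀·(1 − (1/β)·log(1 − (μ₀·v₀·β/(p₀·k))·(L − x))) is well defined on [0, L] (the argument of the logarithm is strictly positive there), satisfies the boundary condition p(L) = p₀, and at every x ∈ [0, L] has derivative p′(x) = −(μ₀·v₀/k)·exp(β·(p(x)/p₀ − 1)). Together with the constant velocity v(x) = v₀ this solves the one-dimensional Barus boundary value problem. -/
/-- If `v₀ < p₀ k / (μ₀ L β)`, then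
`p x = p₀ (1 - (1/β) log (1 - (μ₀ v₀ β / (p₀ k)) (L - x)))` is well defined on `[0, L]`
(the logarithm's argument is strictly positive there), satisfies `p L = p₀`, and at every
`x ∈ [0, L]` has derivative `p' x = -(μ₀ v₀ / k) exp (β (p x / p₀ - 1))`: it solves the
one-dimensional Barus boundary value problem. -/
theorem barus_1d_solution
    (p₀ β μ₀ k L : ℝ) (hp₀ : 0 < p₀) (hβ : 0 < β) (hμ₀ : 0 < μ₀)
    (hk : 0 < k) (hL : 0 < L)
    (v₀ : ℝ) (hv₀ : v₀ < p₀ * k / (μ₀ * L * β))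
    (p : ℝ → ℝ)
    (hp : ∀ x, p x =
      p₀ * (1 - (1 / β) * Real.log (1 - (μ₀ * v₀ * β / (p₀ * k)) * (L - x)))) :
    (∀ x ∈ Set.Icc (0 : ℝ) L, 0 < 1 - (μ₀ * v₀ * β / (p₀ * k)) * (L - x)) ∧
    p L = p₀ ∧
    (∀ x ∈ Set.Icc (0 : ℝ) L,
      HasDerivWithinAt p (-(μ₀ * v₀ / k) * Real.exp (β * (p x / p₀ - 1)))
        (Set.Icc (0 : ℝ) L) x) := by
  have hcL : (μ₀ * v₀ * β / (p₀ * k)) * L < 1 := by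
    rw [lt_div_iff₀ (by positivity)] at hv₀
    rw [div_mul_eq_mul_div, div_lt_one (by positivity)]
    linarith
  have hpos : ∀ x ∈ Set.Icc (0 : ℝ) L, 0 < 1 - (μ₀ * v₀ * β / (p₀ * k)) * (L - x) := by
    rintro x ⟨hx0, hxL⟩
    rcases le_total (μ₀ * v₀ * β / (p₀ * k)) 0 with hc | hc
    · linarith [mul_nonpos_of_nonpos_of_nonneg hc (sub_nonneg.2 hxL)]
    · linarith [mul_nonneg hc hx0]
  refine ⟨hpos, by simp [hp], fun x hx => ?_⟩
  have harg := hpos x hx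
  have hexp : Real.exp (β * (p x / p₀ - 1)) =
      (1 - (μ₀ * v₀ * β / (p₀ * k)) * (L - x))⁻¹ := by
    rw [← Real.exp_log harg, ← Real.exp_neg, hp x]
    congr 1
    field_simp
    ring
  have hderiv := ((((((hasDerivAt_id x).const_sub L).const_mul
    (μ₀ * v₀ * β / (p₀ * k))).const_sub 1).log harg.ne').const_mul (1 / β)).const_sub 1
      |>.const_mul p₀
  rw [hexp, funext hp]
  refine (hderiv.congr_deriv ?_).hasDerivWithinAt
  rw [id_eq, div_eq_mul_inv _ (1 - (μ₀ * v₀ * β / (p₀ * k)) * (L - x))]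
  generalize (1 - (μ₀ * v₀ * β / (p₀ * k)) * (L - x))⁻¹ = r
  field_simp
end

section
/- Suppose v₀ < p₀·k/(μ₀·L·β), and let q : ℝ → ℝ be any function which at every x ∈ [0, L] has derivative q′(x) = −(μ₀·v₀/k)·exp(β·(q(x)/p₀ − 1)) (derivative within [0, L]) and satisfies q(L) = p₀. Then q(x) = p₀·(1 − (1/β)·log(1 − (μ₀·v₀·β/(p₀·k))·(L − x))) for every x ∈ [0, L]; that is, the solution of the one-dimensional Barus boundary value problem is unique. -/
/-- If `v₀ < p₀ k / (μ₀ L β)`, then any `q : ℝ → ℝ` which at every `x ∈ [0, L]` has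
derivative (within `[0, L]`) `q' x = -(μ₀ v₀ / k) exp (β (q x / p₀ - 1))` and satisfies
`q L = p₀` coincides on `[0, L]` with the explicit solution: the solution of the
one-dimensional Barus boundary value problem is unique. -/
theorem barus_1d_uniqueness
    (p₀ β μ₀ k L : ℝ) (hp₀ : 0 < p₀) (hβ : 0 < β) (hμ₀ : 0 < μ₀)
    (hk : 0 < k) (hL : 0 < L)
    (v₀ : ℝ) (hv₀ : v₀ < p₀ * k / (μ₀ * L * β))
    (q : ℝ → ℝ)
    (hq : ∀ x ∈ Set.Icc (0 : ℝ) L,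
      HasDerivWithinAt q (-(μ₀ * v₀ / k) * Real.exp (β * (q x / p₀ - 1)))
        (Set.Icc (0 : ℝ) L) x)
    (hqL : q L = p₀) :
    ∀ x ∈ Set.Icc (0 : ℝ) L,
      q x = p₀ * (1 - (1 / β) * Real.log (1 - (μ₀ * v₀ * β / (p₀ * k)) * (L - x))) := by
  intro x hx
  set c := μ₀ * v₀ * β / (p₀ * k) with hc
  have hderiv : ∀ y ∈ Set.Icc (0 : ℝ) L,
      HasDerivWithinAt (fun y => Real.exp (-(β * (q y / p₀ - 1))) - c * y) 0
        (Set.Icc (0 : ℝ) L) y := by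
    intro y hy
    have h := ((((((hq y hy).div_const p₀).sub_const 1).const_mul β).neg).exp).sub
      ((hasDerivWithinAt_id y (Set.Icc (0 : ℝ) L)).const_mul c)
    refine h.congr_deriv ?_
    have hexp := Real.exp_ne_zero (β * (q y / p₀ - 1))
    simp only [Pi.neg_apply, Real.exp_neg, hc]
    field_simp
    ring
  have hconst := constant_of_derivWithin_zero
    (fun y hy => (hderiv y hy).differentiableWithinAt)
    (fun y hy => (hderiv y (Set.Ico_subset_Icc_self hy)).derivWithin
      (uniqueDiffOn_Icc hL y (Set.Ico_subset_Icc_self hy)))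
  have hxL := (hconst x hx).trans (hconst L (Set.right_mem_Icc.mpr hL.le)).symm
  simp only [hqL, div_self hp₀.ne', sub_self, mul_zero, neg_zero, Real.exp_zero] at hxL
  have hexp : 1 - c * (L - x) = Real.exp (-(β * (q x / p₀ - 1))) := by linarith
  rw [hexp, Real.log_exp]
  field_simp
  ring
end

section
/- Suppose v₀ ≥ p₀·k/(μ₀·L·β). Then there exists no function q : ℝ → ℝ which at every x ∈ [0, L] has derivative q′(x) = −(μ₀·v₀/k)·exp(β·(q(x)/p₀ − 1)) (derivative within [0, L]) and satisfies q(L) = p₀. In other words, this velocity-driven problem under the Barus model is ill-posed: no solution exists. -/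
/-- Along a solution `q` of the Barus equation, `exp (-(β (q / p₀ - 1)))` has constant slope
`β a / p₀`, hence grows by `β a L / p₀` over `[0, L]`. -/
theorem barus_exp_neg_sub_eq {p₀ β a L : ℝ} (hL : 0 < L) {q : ℝ → ℝ}
    (hq : ∀ x ∈ Set.Icc (0 : ℝ) L,
      HasDerivWithinAt q (-a * Real.exp (β * (q x / p₀ - 1))) (Set.Icc (0 : ℝ) L) x) :
    Real.exp (-(β * (q L / p₀ - 1))) - Real.exp (-(β * (q 0 / p₀ - 1))) = β / p₀ * a * L := by
  have hu : ∀ x ∈ Set.Icc (0 : ℝ) L,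
      HasDerivWithinAt (fun y => Real.exp (-(β * (q y / p₀ - 1)))) (β / p₀ * a)
        (Set.Icc (0 : ℝ) L) x := by
    intro x hx
    refine ((((hq x hx).div_const p₀).sub_const 1).const_mul β).fun_neg.exp.congr_deriv ?_
    have he : Real.exp (-(β * (q x / p₀ - 1))) * Real.exp (β * (q x / p₀ - 1)) = 1 := by
      rw [← Real.exp_add, neg_add_cancel, Real.exp_zero]
    linear_combination (β / p₀ * a) * he
  obtain ⟨c, -, hc⟩ := exists_hasDerivAt_eq_slope _ (fun _ => β / p₀ * a) hL
    (fun x hx => (hu x hx).continuousWithinAt)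
    (fun x hx => (hu x (Set.Ioo_subset_Icc_self hx)).hasDerivAt (Icc_mem_nhds hx.1 hx.2))
  rw [sub_zero, eq_div_iff hL.ne'] at hc
  exact hc.symm

/-- If `v₀ ≥ p₀ k / (μ₀ L β)`, then there is no function `q : ℝ → ℝ` which at every
`x ∈ [0, L]` has derivative (within `[0, L]`)
`q' x = -(μ₀ v₀ / k) exp (β (q x / p₀ - 1))` and satisfies `q L = p₀`: the
velocity-driven problem under the Barus model is ill-posed. -/
theorem barus_1d_ill_posedness
    (p₀ β μ₀ k L : ℝ) (hp₀ : 0 < p₀) (hβ : 0 < β) (hμ₀ : 0 < μ₀)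
    (hk : 0 < k) (hL : 0 < L)
    (v₀ : ℝ) (hv₀ : p₀ * k / (μ₀ * L * β) ≤ v₀) :
    ¬ ∃ q : ℝ → ℝ,
      (∀ x ∈ Set.Icc (0 : ℝ) L,
        HasDerivWithinAt q (-(μ₀ * v₀ / k) * Real.exp (β * (q x / p₀ - 1)))
          (Set.Icc (0 : ℝ) L) x) ∧
      q L = p₀ := by
  rintro ⟨q, hq, hqL⟩
  have h := barus_exp_neg_sub_eq hL hq
  rw [hqL, div_self hp₀.ne', sub_self, mul_zero, neg_zero, Real.exp_zero] at h
  have hone : 1 ≤ β / p₀ * (μ₀ * v₀ / k) * L := by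
    rw [div_le_iff₀ (by positivity)] at hv₀
    rw [show β / p₀ * (μ₀ * v₀ / k) * L = v₀ * (μ₀ * L * β) / (p₀ * k) by field_simp,
      one_le_div (by positivity)]
    exact hv₀
  linarith [Real.exp_pos (-(β * (q 0 / p₀ - 1)))]
end

section
/- The function 𝒫(x) = −p₀/β + (μ₀·v₀/k)·(L − x) is the solution of the transformed one-dimensional linear problem: it has derivative 𝒫′(x) = −μ₀·v₀/k at every x and satisfies 𝒫(L) = −p₀/β. Moreover, 𝒫(x) < 0 for all x ∈ [0, L] if and only if v₀ < p₀·k/(μ₀·L·β); hence the Hopf-Cole inversion from 𝒫 back to a real pressure is possible exactly under this condition on the prescribed velocity. -/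
/-- The function `P x = -p₀/β + (μ₀ v₀ / k) (L - x)` solves the transformed
one-dimensional linear problem: `P' x = -μ₀ v₀ / k` everywhere and `P L = -p₀/β`.
Moreover `P x < 0` for all `x ∈ [0, L]` if and only if `v₀ < p₀ k / (μ₀ L β)`, so the
Hopf-Cole inversion back to a real pressure is possible exactly under this condition. -/
theorem transformed_1d_solution_and_inversion_condition
    (p₀ β μ₀ k L : ℝ) (hp₀ : 0 < p₀) (hβ : 0 < β) (hμ₀ : 0 < μ₀)
    (hk : 0 < k) (hL : 0 < L) (v₀ : ℝ)
    (P : ℝ → ℝ)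
    (hP : ∀ x, P x = -p₀ / β + (μ₀ * v₀ / k) * (L - x)) :
    (∀ x : ℝ, HasDerivAt P (-(μ₀ * v₀ / k)) x) ∧
    P L = -p₀ / β ∧
    ((∀ x ∈ Set.Icc (0 : ℝ) L, P x < 0) ↔ v₀ < p₀ * k / (μ₀ * L * β)) := by
  have hPL : P L = -p₀ / β := by simp [hP]
  have hP0 : P 0 = μ₀ * L / k * (v₀ - p₀ * k / (μ₀ * L * β)) := by
    rw [hP]
    field_simp
    ring
  have hP0_neg : P 0 < 0 ↔ v₀ < p₀ * k / (μ₀ * L * β) := by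
    rw [hP0, ← neg_pos, ← mul_neg,
      mul_pos_iff_of_pos_left (by positivity), neg_pos, sub_neg]
  refine ⟨fun x => ?_, hPL, ?_⟩
  · rw [funext hP]
    simpa using (((hasDerivAt_id x).const_sub L).const_mul (μ₀ * v₀ / k)).const_add (-p₀ / β)
  · rw [← hP0_neg]
    refine ⟨fun h => h 0 ⟨le_rfl, hL.le⟩, fun h x hx => ?_⟩
    have hPL_neg : P L < 0 := by
      rw [hPL]
      exact div_neg_of_neg_of_pos (neg_neg_of_pos hp₀) hβ
    have hconv : L * P x = x * P L + (L - x) * P 0 := by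
      simp only [hP]
      ring
    have hx0 := hx.1
    have hxL := hx.2
    by_contra! hPx
    rcases hx0.eq_or_lt with rfl | hx0
    · exact absurd h hPx.not_gt
    · linarith [mul_nonneg hL.le hPx, mul_neg_of_pos_of_neg hx0 hPL_neg,
        mul_nonpos_of_nonneg_of_nonpos (sub_nonneg.2 hxL) h.le]
end
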